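/- Suppose a solution to Disjoint A,B-paths on G exists. Let X ⊆ Z, let M₁ be a perfect matching of H(X) and M₂ a perfect matching of H(Z∖X), and suppose that every path-component of M₁ Δ M₂ has both endpoints in {h(a) : a ∈ A} or both endpoints in {h(b) : b ∈ B}. Then Σ_{external e ∈ M₁} ℓ(e) + Σ_{external e ∈ M₂} ℓ(e) ≤ 2Λ − ℓ_{A,B}. -/

import Mathlib

/-- `f` is a family of `(|A|+|B|)/2` pairwise vertex-disjoint simple paths of `G`,
each with both endpoints in `A` or both endpoints in `B`, such that every vertex of
`A ∪ B` is an endpoint of one of the paths, and `E'` is the union of their edge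
sets.  This witnesses that `E'` is a solution to Disjoint `A`,`B`-paths. -/
def IsPathFamily {V : Type} [DecidableEq V] (G : SimpleGraph V) (A B : Finset V)
    (E' : Set (Sym2 V)) {k : ℕ} (f : Fin k → (u : V) × (v : V) × G.Walk u v) : Prop :=
  k = (A.card + B.card) / 2 ∧
  (∀ i, (f i).2.2.IsPath) ∧
  (∀ i, ((f i).1 ∈ A ∧ (f i).2.1 ∈ A) ∨ ((f i).1 ∈ B ∧ (f i).2.1 ∈ B)) ∧
  (∀ i j, i ≠ j → ∀ x, x ∈ (f i).2.2.support → x ∉ (f j).2.2.support) ∧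
  (∀ z, z ∈ A ∪ B → ∃ i, z = (f i).1 ∨ z = (f i).2.1) ∧
  E' = ⋃ i, {e | e ∈ (f i).2.2.edges}

/-- `E'` is a solution to Disjoint `A`,`B`-paths on `G`. -/
def IsSolution {V : Type} [DecidableEq V] (G : SimpleGraph V) (A B : Finset V)
    (E' : Set (Sym2 V)) : Prop :=
  ∃ (k : ℕ) (f : Fin k → (u : V) × (v : V) × G.Walk u v), IsPathFamily G A B E' f

/-- The length of an edge set: the sum of the lengths of its edges. -/
noncomputable def lengthOf {V : Type} (ℓ : Sym2 V → ℕ) (E' : Set (Sym2 V)) : ℕ :=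
  ∑ᶠ e ∈ E', ℓ e

/-- `ℓ_{A,B}`: the minimum length of a solution to Disjoint `A`,`B`-paths. -/
noncomputable def lAB {V : Type} [DecidableEq V] (G : SimpleGraph V) (A B : Finset V)
    (ℓ : Sym2 V → ℕ) : ℕ :=
  sInf {n | ∃ E', IsSolution G A B E' ∧ lengthOf ℓ E' = n}

/-- `S_{A,B}`: the number of minimum-length solutions to Disjoint `A`,`B`-paths. -/
noncomputable def nSol {V : Type} [DecidableEq V] (G : SimpleGraph V) (A B : Finset V)
    (ℓ : Sym2 V → ℕ) : ℕ :=
  Set.ncard {E' | IsSolution G A B E' ∧ lengthOf ℓ E' = lAB G A B ℓ}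


/-- The vertex type of the gadget graph `H`: `Sum.inl (v, i)` is the gadget vertex
`hᵢ(v)` and `Sum.inr z` is the terminal center `h(z)` (used only for `z ∈ Z`). -/
abbrev HVert (V : Type) : Type := (V × Fin 3) ⊕ V

/-- Base relation for the gadget graph `H`: triangle edges inside nonterminal
gadgets, star edges inside terminal gadgets, and external edges between gadgets
(one external edge `h_{idx u (uv)}(u) h_{idx v (uv)}(v)` for every edge `uv` of `G`). -/
def hRel {V : Type} (G : SimpleGraph V) (idx : V → Sym2 V → Fin 3) (Z : Finset V) :
    HVert V → HVert V → Prop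
  | .inl (u, i), .inl (w, j) =>
      (u = w ∧ u ∉ Z ∧ i ≠ j) ∨
      (G.Adj u w ∧ idx u s(u, w) = i ∧ idx w s(u, w) = j)
  | .inr z, .inl (w, _) => z ∈ Z ∧ z = w
  | _, _ => False

/-- The gadget graph `H` (with terminal set `Z`). -/
def gadgetGraph {V : Type} (G : SimpleGraph V) (idx : V → Sym2 V → Fin 3)
    (Z : Finset V) : SimpleGraph (HVert V) :=
  SimpleGraph.fromRel (hRel G idx Z)

/-- The vertex set of `H(X)`: all gadget vertices, and the centers `h(z)` for `z ∈ X`. -/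
def gadgetVerts {V : Type} (X : Finset V) : Set (HVert V) :=
  fun x => match x with
  | .inl _ => True
  | .inr z => z ∈ X

/-- `M` is (the edge set of) a perfect matching of `H(X)`. -/
def IsPMgadget {V : Type} (G : SimpleGraph V) (idx : V → Sym2 V → Fin 3)
    (Z X : Finset V) (M : Finset (Sym2 (HVert V))) : Prop :=
  (∀ e ∈ M, e ∈ (gadgetGraph G idx Z).edgeSet ∧ ∀ x ∈ e, x ∈ gadgetVerts X) ∧
  (∀ x ∈ gadgetVerts X, ∃! e, e ∈ M ∧ x ∈ e)

/-- The endpoint, in the gadget of `u`, of the external edge of `H` representing the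
edge `uv'` of `G`; this is `f(uv') = h_{idx u (uv')}(u)`. -/
def fEnd {V : Type} (idx : V → Sym2 V → Fin 3) (u v' : V) : HVert V :=
  Sum.inl (u, idx u s(u, v'))

/-- The external edge of `H` representing an edge of `G`. -/
def extEdge {V : Type} (idx : V → Sym2 V → Fin 3) : Sym2 V → Sym2 (HVert V) :=
  Sym2.lift ⟨fun u v => s(fEnd idx u v, fEnd idx v u), by
    intro u v
    exact Sym2.eq_swap⟩

open Classical in
/-- The weight of an edge of `H`: `s ^ ℓ(e)` for the external edge representing the
edge `e` of `G`, and `1` for internal edges (as a polynomial in `ℤ[s]`). -/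
noncomputable def wt {V : Type} (G : SimpleGraph V) (ℓ : Sym2 V → ℕ)
    (idx : V → Sym2 V → Fin 3) (ε : Sym2 (HVert V)) : Polynomial ℤ :=
  if h : ∃ e, e ∈ G.edgeSet ∧ ε = extEdge idx e then Polynomial.X ^ ℓ h.choose else 1

open Classical in
/-- `pm(H(X))`: the sum of the weights of all perfect matchings of `H(X)`. -/
noncomputable def pmPoly {V : Type} [Fintype V] [DecidableEq V] (G : SimpleGraph V)
    (ℓ : Sym2 V → ℕ) (idx : V → Sym2 V → Fin 3) (Z X : Finset V) : Polynomial ℤ :=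
  ∑ M ∈ Finset.univ.filter (fun M : Finset (Sym2 (HVert V)) => IsPMgadget G idx Z X M),
    ∏ e ∈ M, wt G ℓ idx e

open Classical in
/-- The polynomial `p(G,s) = Σ_{X ⊆ Z} (−1)^{|X∩A|} pm(H(X)) pm(H(Z∖X))`. -/
noncomputable def pPoly {V : Type} [Fintype V] [DecidableEq V] (G : SimpleGraph V)
    (A B : Finset V) (ℓ : Sym2 V → ℕ) (idx : V → Sym2 V → Fin 3) : Polynomial ℤ :=
  ∑ X ∈ (A ∪ B).powerset,
    (-1 : Polynomial ℤ) ^ (X ∩ A).card *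
      (pmPoly G ℓ idx (A ∪ B) X * pmPoly G ℓ idx (A ∪ B) ((A ∪ B) \ X))

/-- `Λ`: the total length of all edges of `G`. -/
noncomputable def totalLen {V : Type} (G : SimpleGraph V) (ℓ : Sym2 V → ℕ) : ℕ :=
  ∑ᶠ e ∈ G.edgeSet, ℓ e

namespace SimpleGraph

/-- A connected graph of maximum degree at most two that has a vertex of odd degree has exactly
two such vertices. -/
lemma Connected.card_odd_degree_eq_two {W : Type*} [Fintype W] {P : SimpleGraph W}
    [DecidableRel P.Adj] (hP : P.Connected) (hdeg : ∀ w, P.degree w ≤ 2)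
    (hodd : ∃ w, Odd (P.degree w)) :
    (Finset.univ.filter fun w => Odd (P.degree w)).card = 2 := by
  have heven := P.even_card_odd_degree_vertices
  have hpos : 0 < (Finset.univ.filter fun w => Odd (P.degree w)).card :=
    Finset.card_pos.2 (hodd.imp fun w hw => by simpa using hw)
  have hconn := hP.card_vert_le_card_edgeSet_add_one
  rw [Nat.card_eq_fintype_card, Nat.card_eq_fintype_card, ← edgeFinset_card] at hconn
  have hsum : ∑ w, P.degree w + (Finset.univ.filter fun w => Odd (P.degree w)).card
      ≤ ∑ _w : W, 2 := by
    rw [Finset.card_filter, ← Finset.sum_add_distrib]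
    refine Finset.sum_le_sum fun w _ => ?_
    have := hdeg w
    split_ifs with h
    · rcases h with ⟨m, hm⟩
      omega
    · simpa using this
  rw [P.sum_degrees_eq_twice_card_edges, Finset.sum_const, Finset.card_univ, smul_eq_mul] at hsum
  rcases heven with ⟨m, hm⟩
  omega

open Classical in
lemma ConnectedComponent.card_odd_degree_eq_two {V : Type*} [Fintype V] {P : SimpleGraph V}
    (hdeg : ∀ v, P.degree v ≤ 2) (c : P.ConnectedComponent)
    (hc : ∃ v ∈ c.supp, Odd (P.degree v)) :
    (Finset.univ.filter fun v => Odd (P.degree v) ∧ P.connectedComponentMk v = c).card = 2 := by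
  have hd : ∀ w : c, c.toSimpleGraph.degree w = P.degree w := by
    rintro ⟨w, hw⟩
    rw [← card_neighborFinset_eq_degree, ← card_neighborFinset_eq_degree]
    refine Finset.card_bij (fun x _ => x.1) ?_ ?_ ?_
    · rintro ⟨x, hx⟩ h
      rw [mem_neighborFinset] at h ⊢
      exact h
    · rintro ⟨x, hx⟩ _ ⟨y, hy⟩ _ h
      exact Subtype.ext h
    · intro x hx
      rw [mem_neighborFinset] at hx
      refine ⟨⟨x, c.mem_supp_of_adj_mem_supp hw hx⟩, ?_, rfl⟩
      rw [mem_neighborFinset]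
      exact hx
  rw [← c.connected_toSimpleGraph.card_odd_degree_eq_two (fun w => (hd w).trans_le (hdeg w))
    (by obtain ⟨v, hv, ho⟩ := hc; exact ⟨⟨v, hv⟩, by rwa [hd]⟩)]
  symm
  refine Finset.card_bij (fun x _ => x.1) ?_ ?_ ?_
  · rintro ⟨x, hx⟩ h
    have h' := (Finset.mem_filter.1 h).2
    rw [hd] at h'
    exact Finset.mem_filter.2 ⟨Finset.mem_univ _, h', hx⟩
  · rintro ⟨x, hx⟩ _ ⟨y, hy⟩ _ h
    exact Subtype.ext h
  · intro x hx
    obtain ⟨-, ho, hx⟩ := Finset.mem_filter.1 hx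
    exact ⟨⟨x, hx⟩, Finset.mem_filter.2 ⟨Finset.mem_univ _, by rwa [hd]⟩, rfl⟩

end SimpleGraph

open Classical in
/-- A subgraph of maximum degree at most two whose odd-degree vertices are the terminals, and
whose components do not mix `A` and `B`, contains a solution. -/
lemma exists_isSolution_subset_edgeSet {V : Type} [Fintype V] [DecidableEq V]
    {G P : SimpleGraph V} {A B : Finset V} (hPG : P ≤ G) (hdisj : Disjoint A B)
    (hdeg : ∀ v, P.degree v ≤ 2) (hodd : ∀ v, Odd (P.degree v) ↔ v ∈ A ∪ B)
    (hside : ∀ z ∈ A ∪ B, ∀ z' ∈ A ∪ B, z ≠ z' → P.Reachable z z' →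
      (z ∈ A ∧ z' ∈ A) ∨ (z ∈ B ∧ z' ∈ B)) :
    ∃ E' ⊆ P.edgeSet, IsSolution G A B E' := by
  set C : Finset P.ConnectedComponent := (A ∪ B).image P.connectedComponentMk
  have hfib : ∀ c ∈ C, ((A ∪ B).filter fun v => P.connectedComponentMk v = c).card = 2 := by
    intro c hc
    obtain ⟨v, hv, rfl⟩ := Finset.mem_image.1 hc
    rw [← SimpleGraph.ConnectedComponent.card_odd_degree_eq_two hdeg
      (P.connectedComponentMk v) ⟨v, rfl, (hodd v).2 hv⟩]
    congr 1
    ext w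
    simp only [Finset.mem_filter, hodd, Finset.mem_univ, true_and]
  have hcard : (A.card + B.card) / 2 = C.card := by
    rw [← Finset.card_union_of_disjoint hdisj,
      Finset.card_eq_sum_card_fiberwise (f := P.connectedComponentMk) (t := C)
        (fun v hv => Finset.mem_image_of_mem _ hv), Finset.sum_congr rfl hfib]
    simp
  have hpath : ∀ c : C, ∃ (u v : V) (p : P.Walk u v), p.IsPath ∧ u ≠ v ∧
      ((A ∪ B).filter fun v => P.connectedComponentMk v = c.1) = {u, v} := by
    intro c
    obtain ⟨u, v, huv, he⟩ := Finset.card_eq_two.1 (hfib c c.2)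
    have hu : u ∈ (A ∪ B).filter fun v => P.connectedComponentMk v = c := by simp [he]
    have hv : v ∈ (A ∪ B).filter fun v => P.connectedComponentMk v = c := by simp [he]
    have hr : P.Reachable u v := SimpleGraph.ConnectedComponent.exact
      ((Finset.mem_filter.1 hu).2.trans (Finset.mem_filter.1 hv).2.symm)
    obtain ⟨p, hp⟩ := hr.exists_isPath
    exact ⟨u, v, p, hp, huv, he⟩
  choose a b p hp hne hab using hpath
  have ha : ∀ c, a c ∈ A ∪ B ∧ P.connectedComponentMk (a c) = c := fun c =>
    Finset.mem_filter.1 (show a c ∈ _ by rw [hab c]; simp)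
  have hb : ∀ c, b c ∈ A ∪ B := fun c =>
    (Finset.mem_filter.1 (show b c ∈ _ by rw [hab c]; simp)).1
  have hsupp : ∀ c, ∀ x ∈ (p c).support, P.connectedComponentMk x = c := fun c x hx =>
    (SimpleGraph.ConnectedComponent.sound ⟨(p c).takeUntil x hx⟩).symm.trans (ha c).2
  let σ := C.equivFin.symm
  refine ⟨⋃ i, {e | e ∈ (p (σ i)).edges}, ?_, C.card,
    fun i => ⟨a (σ i), b (σ i), (p (σ i)).mapLe hPG⟩, hcard.symm, ?_, ?_, ?_, ?_, ?_⟩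
  · exact Set.iUnion_subset fun i e he => (p (σ i)).edges_subset_edgeSet he
  · exact fun i => (hp (σ i)).mapLe hPG
  · exact fun i => hside _ (ha (σ i)).1 _ (hb (σ i)) (hne (σ i)) ⟨p (σ i)⟩
  · intro i j hij x hi hj
    simp only [SimpleGraph.Walk.support_mapLe_eq_support] at hi hj
    exact hij (σ.injective (Subtype.ext
      ((hsupp (σ i) x hi).symm.trans (hsupp (σ j) x hj))))
  · intro z hz
    have hc : P.connectedComponentMk z ∈ C := Finset.mem_image_of_mem _ hz
    have : z ∈ (A ∪ B).filter fun v => P.connectedComponentMk v = P.connectedComponentMk z :=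
      Finset.mem_filter.2 ⟨hz, rfl⟩
    rw [hab ⟨_, hc⟩] at this
    exact ⟨σ.symm ⟨_, hc⟩, by simpa using this⟩
  · simp

section GadgetMatching

variable {V : Type} {G : SimpleGraph V} {idx : V → Sym2 V → Fin 3} {Z X : Finset V}
  {M : Finset (Sym2 (HVert V))}

open Classical in
/-- The indices `i` for which the matching `M` covers `hᵢ(v)` by an external edge. -/
noncomputable def extIndices (G : SimpleGraph V) (idx : V → Sym2 V → Fin 3)
    (M : Finset (Sym2 (HVert V))) (v : V) : Finset (Fin 3) :=
  Finset.univ.filter fun i => ∃ u, G.Adj v u ∧ idx v s(v, u) = i ∧ extEdge idx s(v, u) ∈ M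

lemma mem_extIndices {v : V} {i : Fin 3} : i ∈ extIndices G idx M v ↔
    ∃ u, G.Adj v u ∧ idx v s(v, u) = i ∧ extEdge idx s(v, u) ∈ M := by
  simp [extIndices]

lemma extEdge_mk (u v : V) : extEdge idx s(u, v) =
    s(Sum.inl (u, idx u s(u, v)), Sum.inl (v, idx v s(u, v))) := by
  simp [extEdge, fEnd, Sym2.eq_swap (a := v) (b := u)]

lemma gadgetGraph_adj_cases {v : V} {i : Fin 3} {y : HVert V}
    (h : (gadgetGraph G idx Z).Adj (Sum.inl (v, i)) y) :
    (∃ u, G.Adj v u ∧ idx v s(v, u) = i ∧ y = Sum.inl (u, idx u s(v, u))) ∨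
    (v ∉ Z ∧ ∃ j, i ≠ j ∧ y = Sum.inl (v, j)) ∨ (v ∈ Z ∧ y = Sum.inr v) := by
  rw [gadgetGraph, SimpleGraph.fromRel_adj] at h
  obtain ⟨-, h⟩ := h
  rcases y with ⟨w, j⟩ | z
  · simp only [hRel] at h
    rcases h with (⟨rfl, hv, hij⟩ | ⟨ha, hi, hj⟩) | (⟨rfl, hv, hij⟩ | ⟨ha, hj, hi⟩)
    · exact Or.inr (Or.inl ⟨hv, j, hij, rfl⟩)
    · exact Or.inl ⟨w, ha, hi, by rw [hj]⟩
    · exact Or.inr (Or.inl ⟨hv, j, hij.symm, rfl⟩)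
    · rw [Sym2.eq_swap] at hi hj
      exact Or.inl ⟨w, ha.symm, hi, by rw [hj]⟩
  · simp only [hRel, false_or] at h
    obtain ⟨hz, rfl⟩ := h
    exact Or.inr (Or.inr ⟨hz, rfl⟩)

lemma IsPMgadget.adj (hM : IsPMgadget G idx Z X M) {x y : HVert V} (h : s(x, y) ∈ M) :
    (gadgetGraph G idx Z).Adj x y :=
  (hM.1 _ h).1

lemma IsPMgadget.eq_of_mem (hM : IsPMgadget G idx Z X M) {x y y' : HVert V}
    (h : s(x, y) ∈ M) (h' : s(x, y') ∈ M) : y = y' := by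
  have hx := (hM.1 _ h).2 x (Sym2.mem_mk_left _ _)
  have := (hM.2 x hx).unique ⟨h, Sym2.mem_mk_left _ _⟩ ⟨h', Sym2.mem_mk_left _ _⟩
  exact Sym2.congr_right.1 this

lemma IsPMgadget.exists_mem (hM : IsPMgadget G idx Z X M) {x : HVert V}
    (hx : x ∈ gadgetVerts X) : ∃ y, s(x, y) ∈ M := by
  obtain ⟨e, ⟨he, y, rfl⟩, -⟩ := hM.2 x hx
  exact ⟨y, he⟩

lemma IsPMgadget.cases (hM : IsPMgadget G idx Z X M) (v : V) (i : Fin 3) :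
    i ∈ extIndices G idx M v ∨
    (v ∉ Z ∧ ∃ j, i ≠ j ∧ s(Sum.inl (v, i), Sum.inl (v, j)) ∈ M) ∨
    (v ∈ Z ∧ s(Sum.inl (v, i), Sum.inr v) ∈ M) := by
  obtain ⟨y, hy⟩ := hM.exists_mem (x := Sum.inl (v, i)) trivial
  rcases gadgetGraph_adj_cases (hM.adj hy) with ⟨u, ha, hi, rfl⟩ | ⟨hv, j, hij, rfl⟩ | ⟨hv, rfl⟩
  · refine Or.inl (mem_extIndices.2 ⟨u, ha, hi, ?_⟩)
    rwa [extEdge_mk, hi]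
  · exact Or.inr (Or.inl ⟨hv, j, hij, hy⟩)
  · exact Or.inr (Or.inr ⟨hv, hy⟩)

lemma IsPMgadget.exists_of_mem_extIndices (hM : IsPMgadget G idx Z X M) {v : V} {i : Fin 3}
    {y : HVert V} (hi : i ∈ extIndices G idx M v) (hy : s(Sum.inl (v, i), y) ∈ M) :
    ∃ u j, u ≠ v ∧ y = Sum.inl (u, j) := by
  obtain ⟨u, ha, rfl, he⟩ := mem_extIndices.1 hi
  rw [extEdge_mk] at he
  exact ⟨u, _, ha.ne', hM.eq_of_mem hy he⟩

lemma IsPMgadget.triangle_mem_iff (hM : IsPMgadget G idx Z X M) {v : V} (hv : v ∉ Z)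
    {j k : Fin 3} (hjk : j ≠ k) : s(Sum.inl (v, j), Sum.inl (v, k)) ∈ M ↔
      j ∉ extIndices G idx M v ∧ k ∉ extIndices G idx M v := by
  have hout : ∀ {j k : Fin 3}, s(Sum.inl (v, j), Sum.inl (v, k)) ∈ M →
      j ∉ extIndices G idx M v := by
    intro j k h hj
    obtain ⟨u, i, hu, he⟩ := hM.exists_of_mem_extIndices hj h
    simp only [Sum.inl.injEq, Prod.mk.injEq] at he
    exact hu he.1.symm
  refine ⟨fun h => ⟨hout h, hout (by rwa [Sym2.eq_swap])⟩, fun ⟨hj, hk⟩ => ?_⟩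
  obtain ⟨j', hj', h₁⟩ : ∃ i, j ≠ i ∧ s(Sum.inl (v, j), Sum.inl (v, i)) ∈ M := by
    simpa [hj, hv] using hM.cases v j
  obtain ⟨k', hk', h₂⟩ : ∃ i, k ≠ i ∧ s(Sum.inl (v, k), Sum.inl (v, i)) ∈ M := by
    simpa [hk, hv] using hM.cases v k
  by_cases h1 : j' = k
  · rwa [← h1]
  by_cases h2 : k' = j
  · rwa [Sym2.eq_swap, ← h2]
  have h3 : j' = k' := by omega
  subst h3
  rw [Sym2.eq_swap] at h₁ h₂
  have := hM.eq_of_mem h₁ h₂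
  simp only [Sum.inl.injEq, Prod.mk.injEq, true_and] at this
  exact absurd this hjk

lemma IsPMgadget.odd_card_extIndices (hM : IsPMgadget G idx Z X M) {v : V} (hv : v ∉ Z) :
    Odd (extIndices G idx M v).card := by
  have hmem : ∀ i ∉ extIndices G idx M v, ∃ j, i ≠ j ∧ j ∉ extIndices G idx M v := by
    intro i hi
    obtain ⟨j, hj, h⟩ : ∃ j, i ≠ j ∧ s(Sum.inl (v, i), Sum.inl (v, j)) ∈ M := by
      simpa [hi, hv] using hM.cases v i
    exact ⟨j, hj, ((hM.triangle_mem_iff hv hj).1 h).2⟩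
  have hne : extIndices G idx M v ≠ ∅ := by
    intro h
    have h₁ := (hM.triangle_mem_iff hv (show (0 : Fin 3) ≠ 1 by decide)).2 (by simp [h])
    have h₂ := (hM.triangle_mem_iff hv (show (0 : Fin 3) ≠ 2 by decide)).2 (by simp [h])
    simpa using hM.eq_of_mem h₁ h₂
  generalize extIndices G idx M v = S at hmem hne
  revert S
  decide

lemma IsPMgadget.star_mem_iff (hM : IsPMgadget G idx Z X M) {z : V} (hz : z ∈ Z) (i : Fin 3) :
    s(Sum.inl (z, i), Sum.inr z) ∈ M ↔ i ∉ extIndices G idx M z := by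
  refine ⟨fun h hi => ?_, fun hi => ?_⟩
  · obtain ⟨u, j, -, he⟩ := hM.exists_of_mem_extIndices hi h
    simp at he
  · simpa [hi, hz] using hM.cases z i

lemma IsPMgadget.extIndices_of_notMem (hM : IsPMgadget G idx Z X M) {z : V} (hz : z ∈ Z)
    (hzX : z ∉ X) : extIndices G idx M z = Finset.univ := by
  refine Finset.eq_univ_iff_forall.2 fun i => by_contra fun hi => hzX ?_
  exact (hM.1 _ ((hM.star_mem_iff hz i).2 hi)).2 (Sum.inr z) (Sym2.mem_mk_right _ _)

lemma IsPMgadget.card_compl_extIndices_of_mem (hM : IsPMgadget G idx Z X M) {z : V} (hz : z ∈ Z)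
    (hzX : z ∈ X) : (extIndices G idx M z)ᶜ.card = 1 := by
  obtain ⟨y, hy⟩ := hM.exists_mem (x := Sum.inr z) hzX
  obtain ⟨i, rfl⟩ : ∃ i, y = Sum.inl (z, i) := by
    have h := hM.adj hy
    rw [gadgetGraph, SimpleGraph.fromRel_adj] at h
    rcases y with ⟨w, j⟩ | w
    · simp only [hRel, or_false] at h
      exact ⟨j, by rw [h.2.2]⟩
    · simp [hRel] at h
  refine Finset.card_eq_one.2 ⟨i, ?_⟩
  ext j
  rw [Finset.mem_compl, ← hM.star_mem_iff hz, Finset.mem_singleton]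
  constructor
  · intro h
    rw [Sym2.eq_swap] at h
    simpa using hM.eq_of_mem h hy
  · rintro rfl
    rwa [Sym2.eq_swap]

end GadgetMatching

section TwoMatchings

variable {V : Type} {G : SimpleGraph V} {idx : V → Sym2 V → Fin 3} {Z X : Finset V}
  {M₁ M₂ : Finset (Sym2 (HVert V))}

/-- The spanning subgraph of `G` formed by the edges whose external edge lies in exactly one of
the two matchings. -/
def onceGraph (G : SimpleGraph V) (idx : V → Sym2 V → Fin 3)
    (M₁ M₂ : Finset (Sym2 (HVert V))) : SimpleGraph V where
  Adj u v := G.Adj u v ∧ ¬ (extEdge idx s(u, v) ∈ M₁ ↔ extEdge idx s(u, v) ∈ M₂)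
  symm := ⟨fun u v h => by rw [Sym2.eq_swap]; exact ⟨h.1.symm, h.2⟩⟩
  loopless := ⟨fun u h => h.1.ne rfl⟩

lemma extEdge_mem_iff_mem_extIndices {M : Finset (Sym2 (HVert V))}
    (hidx : ∀ v : V, Set.InjOn (idx v) (G.incidenceSet v)) {u v : V} (h : G.Adj v u) :
    extEdge idx s(v, u) ∈ M ↔ idx v s(v, u) ∈ extIndices G idx M v := by
  rw [mem_extIndices]
  refine ⟨fun hm => ⟨u, h, rfl, hm⟩, fun ⟨w, hw, he, hm⟩ => ?_⟩
  rwa [← hidx v ⟨hw, Sym2.mem_mk_left _ _⟩ ⟨h, Sym2.mem_mk_left _ _⟩ he]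

lemma onceGraph_adj_iff (hidx : ∀ v : V, Set.InjOn (idx v) (G.incidenceSet v)) {u v : V} :
    (onceGraph G idx M₁ M₂).Adj v u ↔ G.Adj v u ∧
      idx v s(v, u) ∈ symmDiff (extIndices G idx M₁ v) (extIndices G idx M₂ v) := by
  refine and_congr_right fun h => ?_
  rw [extEdge_mem_iff_mem_extIndices hidx h, extEdge_mem_iff_mem_extIndices hidx h,
    Finset.mem_symmDiff]
  tauto

open Classical in
lemma degree_onceGraph [Fintype V] (hcubic : ∀ v : V, (G.neighborSet v).ncard = 3)
    (hidx : ∀ v : V, Set.InjOn (idx v) (G.incidenceSet v)) (v : V) :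
    (onceGraph G idx M₁ M₂).degree v =
      (symmDiff (extIndices G idx M₁ v) (extIndices G idx M₂ v)).card := by
  have hinj : Set.InjOn (fun u => idx v s(v, u)) (G.neighborSet v) := fun u hu w hw h =>
    Sym2.congr_right.1 (hidx v ⟨hu, Sym2.mem_mk_left _ _⟩ ⟨hw, Sym2.mem_mk_left _ _⟩ h)
  have hsurj : (fun u => idx v s(v, u)) '' G.neighborSet v = Set.univ := by
    refine Set.eq_of_subset_of_ncard_le (Set.subset_univ _) ?_
    rw [hinj.ncard_image, hcubic]
    simp
  rw [← SimpleGraph.card_neighborFinset_eq_degree]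
  refine Finset.card_bij (fun u _ => idx v s(v, u)) ?_ ?_ ?_
  · intro u hu
    rw [SimpleGraph.mem_neighborFinset, onceGraph_adj_iff hidx] at hu
    exact hu.2
  · intro u hu w hw h
    rw [SimpleGraph.mem_neighborFinset] at hu hw
    exact hinj hu.1 hw.1 h
  · intro i hi
    obtain ⟨u, hu, rfl⟩ : i ∈ (fun u => idx v s(v, u)) '' G.neighborSet v := hsurj ▸ trivial
    exact ⟨u, by rw [SimpleGraph.mem_neighborFinset, onceGraph_adj_iff hidx]; exact ⟨hu, hi⟩, rfl⟩

lemma IsPMgadget.card_symmDiff_of_notMem {X' : Finset V} (hM₁ : IsPMgadget G idx Z X M₁)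
    (hM₂ : IsPMgadget G idx Z X' M₂) {v : V} (hv : v ∉ Z) :
    (symmDiff (extIndices G idx M₁ v) (extIndices G idx M₂ v)).card = 0 ∨
    (symmDiff (extIndices G idx M₁ v) (extIndices G idx M₂ v)).card = 2 := by
  have h₁ := hM₁.odd_card_extIndices hv
  have h₂ := hM₂.odd_card_extIndices hv
  generalize extIndices G idx M₁ v = S at h₁
  generalize extIndices G idx M₂ v = T at h₂
  revert S T
  decide

variable [DecidableEq V]

lemma IsPMgadget.card_symmDiff_of_mem (hM₁ : IsPMgadget G idx Z X M₁)
    (hM₂ : IsPMgadget G idx Z (Z \ X) M₂) {z : V} (hz : z ∈ Z) :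
    (symmDiff (extIndices G idx M₁ z) (extIndices G idx M₂ z)).card = 1 := by
  by_cases hzX : z ∈ X
  · have h₁ := hM₁.card_compl_extIndices_of_mem hz hzX
    rw [hM₂.extIndices_of_notMem hz (by simp [hzX])]
    simpa [← Finset.top_eq_univ] using h₁
  · have h₂ := hM₂.card_compl_extIndices_of_mem hz (Finset.mem_sdiff.2 ⟨hz, hzX⟩)
    rw [hM₁.extIndices_of_notMem hz hzX]
    simpa [← Finset.top_eq_univ] using h₂

/-- The graph on the gadget vertices whose edge set is `M₁ Δ M₂`. -/
abbrev symmDiffGraph (M₁ M₂ : Finset (Sym2 (HVert V))) : SimpleGraph (HVert V) :=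
  SimpleGraph.fromEdgeSet (↑(symmDiff M₁ M₂) : Set (Sym2 (HVert V)))

lemma symmDiffGraph_adj {x y : HVert V} (hxy : x ≠ y) (h : ¬ (s(x, y) ∈ M₁ ↔ s(x, y) ∈ M₂)) :
    (symmDiffGraph M₁ M₂).Adj x y := by
  rw [SimpleGraph.fromEdgeSet_adj, Finset.mem_coe, Finset.mem_symmDiff]
  exact ⟨by tauto, hxy⟩

lemma symmDiffGraph_adj_of_onceGraph {u v : V} (h : (onceGraph G idx M₁ M₂).Adj u v) :
    (symmDiffGraph M₁ M₂).Adj (Sum.inl (u, idx u s(u, v))) (Sum.inl (v, idx v s(v, u))) := by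
  refine symmDiffGraph_adj (by simp [h.1.ne]) ?_
  rw [Sym2.eq_swap (a := v), ← extEdge_mk]
  exact h.2

lemma IsPMgadget.symmDiffGraph_adj_star {X' : Finset V} (hM₁ : IsPMgadget G idx Z X M₁)
    (hM₂ : IsPMgadget G idx Z X' M₂) {z : V} (hz : z ∈ Z) {i : Fin 3}
    (hi : i ∈ symmDiff (extIndices G idx M₁ z) (extIndices G idx M₂ z)) :
    (symmDiffGraph M₁ M₂).Adj (Sum.inl (z, i)) (Sum.inr z) := by
  refine symmDiffGraph_adj (by simp) ?_
  rw [hM₁.star_mem_iff hz, hM₂.star_mem_iff hz]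
  rw [Finset.mem_symmDiff] at hi
  tauto

lemma IsPMgadget.symmDiffGraph_adj_triangle {X' : Finset V} (hM₁ : IsPMgadget G idx Z X M₁)
    (hM₂ : IsPMgadget G idx Z X' M₂) {v : V} (hv : v ∉ Z) {i j : Fin 3} (hij : i ≠ j)
    (h : ¬ ((i ∉ extIndices G idx M₁ v ∧ j ∉ extIndices G idx M₁ v) ↔
      (i ∉ extIndices G idx M₂ v ∧ j ∉ extIndices G idx M₂ v))) :
    (symmDiffGraph M₁ M₂).Adj (Sum.inl (v, i)) (Sum.inl (v, j)) := by
  refine symmDiffGraph_adj (by simp [hij]) ?_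
  rwa [hM₁.triangle_mem_iff hv hij, hM₂.triangle_mem_iff hv hij]

set_option synthInstance.maxSize 1000 in
lemma exists_path_of_mem_symmDiff : ∀ (S T : Finset (Fin 3)), Odd S.card → Odd T.card →
    ∀ i ∈ symmDiff S T, ∀ j ∈ symmDiff S T, i ≠ j →
      ¬ ((i ∉ S ∧ j ∉ S) ↔ (i ∉ T ∧ j ∉ T)) ∨
      ∃ k, i ≠ k ∧ k ≠ j ∧ ¬ ((i ∉ S ∧ k ∉ S) ↔ (i ∉ T ∧ k ∉ T)) ∧
        ¬ ((k ∉ S ∧ j ∉ S) ↔ (k ∉ T ∧ j ∉ T)) := by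
  decide

lemma IsPMgadget.reachable_of_mem_symmDiff {X' : Finset V} (hM₁ : IsPMgadget G idx Z X M₁)
    (hM₂ : IsPMgadget G idx Z X' M₂) {v : V} {i j : Fin 3}
    (hi : i ∈ symmDiff (extIndices G idx M₁ v) (extIndices G idx M₂ v))
    (hj : j ∈ symmDiff (extIndices G idx M₁ v) (extIndices G idx M₂ v)) :
    (symmDiffGraph M₁ M₂).Reachable (Sum.inl (v, i)) (Sum.inl (v, j)) := by
  by_cases hv : v ∈ Z
  · exact (hM₁.symmDiffGraph_adj_star hM₂ hv hi).reachable.trans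
      (hM₁.symmDiffGraph_adj_star hM₂ hv hj).symm.reachable
  rcases eq_or_ne i j with rfl | hij
  · exact SimpleGraph.Reachable.refl _
  rcases exists_path_of_mem_symmDiff _ _ (hM₁.odd_card_extIndices hv)
    (hM₂.odd_card_extIndices hv) i hi j hj hij with h | ⟨k, hik, hkj, h, h'⟩
  · exact (hM₁.symmDiffGraph_adj_triangle hM₂ hv hij h).reachable
  · exact (hM₁.symmDiffGraph_adj_triangle hM₂ hv hik h).reachable.trans
      (hM₁.symmDiffGraph_adj_triangle hM₂ hv hkj h').reachable

lemma IsPMgadget.reachable_of_onceGraph {X' : Finset V} (hM₁ : IsPMgadget G idx Z X M₁)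
    (hM₂ : IsPMgadget G idx Z X' M₂)
    (hidx : ∀ v : V, Set.InjOn (idx v) (G.incidenceSet v)) {v w : V}
    (h : (onceGraph G idx M₁ M₂).Reachable v w) {i j : Fin 3}
    (hi : i ∈ symmDiff (extIndices G idx M₁ v) (extIndices G idx M₂ v))
    (hj : j ∈ symmDiff (extIndices G idx M₁ w) (extIndices G idx M₂ w)) :
    (symmDiffGraph M₁ M₂).Reachable (Sum.inl (v, i)) (Sum.inl (w, j)) := by
  obtain ⟨p⟩ := h
  induction p generalizing i with
  | nil => exact hM₁.reachable_of_mem_symmDiff hM₂ hi hj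
  | cons ha p ih =>
    exact (hM₁.reachable_of_mem_symmDiff hM₂ hi ((onceGraph_adj_iff hidx).1 ha).2).trans
      ((symmDiffGraph_adj_of_onceGraph ha).reachable.trans
        (ih ((onceGraph_adj_iff hidx).1 ha.symm).2 hj))

end TwoMatchings

lemma finsum_mem_edgeSet_and {V : Type} [Fintype V] [DecidableEq V] (G : SimpleGraph V)
    [DecidableRel G.Adj] (ℓ : Sym2 V → ℕ) (p : Sym2 V → Prop) [DecidablePred p] :
    ∑ᶠ e ∈ {e | e ∈ G.edgeSet ∧ p e}, ℓ e = ∑ e ∈ G.edgeFinset, if p e then ℓ e else 0 := by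
  rw [← Finset.sum_filter]
  exact finsum_mem_eq_sum_of_inter_support_eq _ (by ext; simp)

/-- The edges covered by exactly one matching are counted once on the left, and those covered by
none or by both are counted zero or two times. -/
lemma finsum_add_finsum_add_lengthOf_le {V : Type} [Fintype V] [DecidableEq V]
    (G : SimpleGraph V) (ℓ : Sym2 V → ℕ) (idx : V → Sym2 V → Fin 3)
    (M₁ M₂ : Finset (Sym2 (HVert V))) {E' : Set (Sym2 V)}
    (hE' : E' ⊆ (onceGraph G idx M₁ M₂).edgeSet) :
    (∑ᶠ e ∈ {e : Sym2 V | e ∈ G.edgeSet ∧ extEdge idx e ∈ M₁}, ℓ e) +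
      (∑ᶠ e ∈ {e : Sym2 V | e ∈ G.edgeSet ∧ extEdge idx e ∈ M₂}, ℓ e) + lengthOf ℓ E' ≤
      2 * totalLen G ℓ := by
  classical
  have hE : ∀ e ∈ E', e ∈ G.edgeSet ∧ ¬ (extEdge idx e ∈ M₁ ↔ extEdge idx e ∈ M₂) := by
    intro e he
    induction e using Sym2.ind with
    | _ u v => exact hE' he
  have h₃ : lengthOf ℓ E' = ∑ e ∈ G.edgeFinset, if e ∈ E' then ℓ e else 0 := by
    rw [← finsum_mem_edgeSet_and]
    exact congrArg (lengthOf ℓ) (Set.ext fun e => ⟨fun he => ⟨(hE e he).1, he⟩, fun he => he.2⟩)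
  have h₀ : totalLen G ℓ = ∑ e ∈ G.edgeFinset, ℓ e :=
    finsum_mem_eq_sum_of_inter_support_eq _ (by simp)
  rw [finsum_mem_edgeSet_and, finsum_mem_edgeSet_and, h₃, h₀, Finset.mul_sum,
    ← Finset.sum_add_distrib, ← Finset.sum_add_distrib]
  refine Finset.sum_le_sum fun e _ => ?_
  have := hE e
  split_ifs <;> first | omega | tauto

/-!
STATEMENT 6.  Suppose a solution to Disjoint `A`,`B`-paths on the cubic graph `G`
exists.  Let `X ⊆ Z`, `M₁` a perfect matching of `H(X)`, `M₂` a perfect matching of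
`H(Z∖X)`, and suppose every path-component of `M₁ Δ M₂` has both endpoints among
the `A`-centers or both among the `B`-centers.  Then the total `ℓ`-length of the
external edges of `M₁` plus that of the external edges of `M₂` is at most
`2Λ − ℓ_{A,B}`.
-/
theorem stmt6 {V : Type} [Fintype V] [DecidableEq V]
    (G : SimpleGraph V) (A B : Finset V) (ℓ : Sym2 V → ℕ)
    (idx : V → Sym2 V → Fin 3)
    (hdisj : Disjoint A B) (hA : Even A.card) (hB : Even B.card)
    (hcubic : ∀ v : V, (G.neighborSet v).ncard = 3)
    (hidx : ∀ v : V, Set.InjOn (idx v) (G.incidenceSet v))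
    (hℓ : ∀ e ∈ G.edgeSet, 1 ≤ ℓ e)
    (hsol : ∃ E', IsSolution G A B E')
    (X : Finset V) (hX : X ⊆ A ∪ B)
    (M₁ M₂ : Finset (Sym2 (HVert V)))
    (hM₁ : IsPMgadget G idx (A ∪ B) X M₁)
    (hM₂ : IsPMgadget G idx (A ∪ B) ((A ∪ B) \ X) M₂)
    (D : SimpleGraph (HVert V))
    (hD : D = SimpleGraph.fromEdgeSet (↑(symmDiff M₁ M₂) : Set (Sym2 (HVert V))))
    -- every path-component of `M₁ Δ M₂` has both endpoints in `A`-centers or both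
    -- in `B`-centers:
    (hside : ∀ z z' : V, z ∈ A ∪ B → z' ∈ A ∪ B → z ≠ z' →
      D.Reachable (Sum.inr z) (Sum.inr z') →
      ((z ∈ A ∧ z' ∈ A) ∨ (z ∈ B ∧ z' ∈ B))) :
    (∑ᶠ e ∈ {e : Sym2 V | e ∈ G.edgeSet ∧ extEdge idx e ∈ M₁}, ℓ e) +
      (∑ᶠ e ∈ {e : Sym2 V | e ∈ G.edgeSet ∧ extEdge idx e ∈ M₂}, ℓ e) ≤
      2 * totalLen G ℓ - lAB G A B ℓ := by
  classical
  subst hD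
  have hdegree := degree_onceGraph (M₁ := M₁) (M₂ := M₂) hcubic hidx
  have hterm : ∀ z ∈ A ∪ B, ((onceGraph G idx M₁ M₂).degree z) = 1 := fun z hz =>
    (hdegree z).trans (hM₁.card_symmDiff_of_mem hM₂ hz)
  have hnonterm : ∀ v ∉ A ∪ B, (onceGraph G idx M₁ M₂).degree v = 0 ∨
      (onceGraph G idx M₁ M₂).degree v = 2 := fun v hv => by
    rw [hdegree]
    exact hM₁.card_symmDiff_of_notMem hM₂ hv
  have hstar : ∀ z ∈ A ∪ B, ∃ i, i ∈ symmDiff (extIndices G idx M₁ z) (extIndices G idx M₂ z) :=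
    fun z hz => Finset.card_pos.1 (by rw [hM₁.card_symmDiff_of_mem hM₂ hz]; exact one_pos)
  obtain ⟨E', hE', hsolE'⟩ := exists_isSolution_subset_edgeSet (G := G)
    (P := onceGraph G idx M₁ M₂) (A := A) (B := B) (fun _ _ h => h.1) hdisj
    (fun v => by
      by_cases hv : v ∈ A ∪ B
      · simp [hterm v hv]
      · rcases hnonterm v hv with h | h <;> simp [h])
    (fun v => by
      by_cases hv : v ∈ A ∪ B
      · simp only [hterm v hv, hv, odd_one]
      · rcases hnonterm v hv with h | h <;> simp only [h, hv, iff_false] <;> decide)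
    (fun z hz z' hz' hne hr => by
      obtain ⟨i, hi⟩ := hstar z hz
      obtain ⟨j, hj⟩ := hstar z' hz'
      exact hside z z' hz hz' hne
        ((hM₁.symmDiffGraph_adj_star hM₂ hz hi).symm.reachable.trans
          ((hM₁.reachable_of_onceGraph hM₂ hidx hr hi hj).trans
            (hM₁.symmDiffGraph_adj_star hM₂ hz' hj).reachable)))
  have hle := finsum_add_finsum_add_lengthOf_le G ℓ idx M₁ M₂ hE'
  have hmin : lAB G A B ℓ ≤ lengthOf ℓ E' := Nat.sInf_le ⟨E', hsolE', rfl⟩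
  omega
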